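/- arXiv:2310.14423 — 4 statements merged into one kernel-verified Lean document; each statement's English description precedes it below -/
import Mathlib

section
/- The function ψ is strictly monotonically increasing on ℝ: for all real numbers x < y, ψ(x) < ψ(y). -/
noncomputable def psi (x : ℝ) : ℝ := if x = 0 then 0 else (Real.exp (-x) - 1 + x) / x

/-- Away from the origin, `ψ` is one minus the slope of the exponential between `0` and `-x`. -/
theorem psi_eq_one_sub_slope_exp {x : ℝ} (hx : x ≠ 0) :
    psi x = 1 - (Real.exp (-x) - Real.exp 0) / (-x - 0) := by
  rw [psi, if_neg hx, Real.exp_zero, sub_zero, div_neg]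
  field_simp
  ring

theorem psi_zero : psi 0 = 0 := if_pos rfl

theorem psi_numerator_pos {x : ℝ} (hx : x ≠ 0) : 0 < Real.exp (-x) - 1 + x := by
  linarith [Real.add_one_lt_exp (neg_ne_zero.mpr hx)]

theorem psi_pos {x : ℝ} (hx : 0 < x) : 0 < psi x := by
  rw [psi, if_neg hx.ne']
  exact div_pos (psi_numerator_pos hx.ne') hx

theorem psi_neg {x : ℝ} (hx : x < 0) : psi x < 0 := by
  rw [psi, if_neg hx.ne]
  exact div_neg_of_pos_of_neg (psi_numerator_pos hx.ne) hx

/-- The function ψ is strictly monotonically increasing on ℝ: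
for all real numbers `x < y`, `ψ x < ψ y`. -/
theorem psi_strictMono : ∀ x y : ℝ, x < y → psi x < psi y := by
  intro x y hxy
  rcases eq_or_ne x 0 with rfl | hx
  · rw [psi_zero]
    exact psi_pos hxy
  rcases eq_or_ne y 0 with rfl | hy
  · rw [psi_zero]
    exact psi_neg hxy
  rw [psi_eq_one_sub_slope_exp hx, psi_eq_one_sub_slope_exp hy]
  exact sub_lt_sub_left (strictConvexOn_exp.secant_strict_mono (Set.mem_univ 0)
    (Set.mem_univ (-y)) (Set.mem_univ (-x)) (neg_ne_zero.mpr hy) (neg_ne_zero.mpr hx)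
    (neg_lt_neg hxy)) 1
end

section
/- For every d ≥ 1 and every family of strictly positive reals λ_1, …, λ_d, the d×d real matrix C with entries C_{ij} = 1/(λ_i + λ_j) is positive semidefinite. -/
/-- For every `d ≥ 1` and every family of strictly positive reals `λ_1, …, λ_d`,
the `d×d` real matrix `C` with entries `C_{ij} = 1/(λ_i + λ_j)` is positive
semidefinite. -/
theorem cauchy_like_posSemidef (d : ℕ) (hd : 1 ≤ d) (lam : Fin d → ℝ)
    (hlam : ∀ i, 0 < lam i) :
    (Matrix.of fun i j : Fin d => 1 / (lam i + lam j)).PosSemidef := by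
  have hneg (i j : Fin d) : -(lam i + lam j) < 0 := by linarith [hlam i, hlam j]
  have hint (i j : Fin d) (c : ℝ) : MeasureTheory.IntegrableOn
      (fun t => c * Real.exp (-(lam i + lam j) * t)) (Set.Ioi 0) :=
    (integrableOn_exp_mul_Ioi (hneg i j) 0).const_mul c
  refine .of_dotProduct_mulVec_nonneg ?_ fun x => ?_
  · ext i j
    simp [add_comm]
  -- The quadratic form is the integral over `t > 0` of a square.
  have key : star x ⬝ᵥ (Matrix.of fun i j : Fin d => 1 / (lam i + lam j)).mulVec x =
      ∫ t in Set.Ioi (0 : ℝ), (∑ i, x i * Real.exp (-lam i * t)) ^ 2 := by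
    have hsq (t : ℝ) : (∑ i, x i * Real.exp (-lam i * t)) ^ 2 =
        ∑ i, ∑ j, x i * x j * Real.exp (-(lam i + lam j) * t) := by
      rw [sq, Finset.sum_mul_sum]
      refine Finset.sum_congr rfl fun i _ => Finset.sum_congr rfl fun j _ => ?_
      rw [neg_add, add_mul, Real.exp_add]
      ring
    simp_rw [hsq]
    rw [MeasureTheory.integral_finsetSum _
      fun i _ => MeasureTheory.integrable_finsetSum _ fun j _ => hint i j _]
    simp only [dotProduct, Matrix.mulVec, Finset.mul_sum]
    refine Finset.sum_congr rfl fun i _ => ?_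
    rw [MeasureTheory.integral_finsetSum _ fun j _ => hint i j _]
    refine Finset.sum_congr rfl fun j _ => ?_
    rw [MeasureTheory.integral_const_mul, integral_exp_mul_Ioi (hneg i j)]
    simp only [Pi.star_apply, star_trivial, Matrix.of_apply, mul_zero, Real.exp_zero,
      neg_div_neg_eq]
    ring
  rw [key]
  exact MeasureTheory.integral_nonneg fun t => sq_nonneg _
end

section
/- For every d ≥ 1, every family of strictly positive reals λ_1, …, λ_d, and every real β > 0, the d×d real matrix G with entries G_{ij} = ψ(β(λ_i + λ_j))/(λ_i + λ_j) is positive semidefinite. -/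
/-- The kernel `ψ(βs)/s` is an average of the exponentials `e^{-ts}`, `0 ≤ t ≤ β`, with
nonnegative weight `β - t`. -/
theorem psi_mul_div_eq_integral {β s : ℝ} (hβ : β ≠ 0) (hs : s ≠ 0) :
    psi (β * s) / s = β⁻¹ * ∫ t in (0 : ℝ)..β, (β - t) * Real.exp (-(t * s)) := by
  have hderiv (t : ℝ) : HasDerivAt
      (fun t : ℝ => -(β - t) * Real.exp (-(t * s)) / s + Real.exp (-(t * s)) / s ^ 2)
      ((β - t) * Real.exp (-(t * s))) t := by
    have hexp : HasDerivAt (fun t : ℝ => Real.exp (-(t * s)))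
        (Real.exp (-(t * s)) * -(1 * s)) t := ((hasDerivAt_id t).mul_const s).neg.exp
    have hlin : HasDerivAt (fun t : ℝ => -(β - t)) (-(-1)) t :=
      ((hasDerivAt_id t).const_sub β).neg
    refine (((hlin.mul hexp).div_const s).add (hexp.div_const (s ^ 2))).congr_deriv ?_
    field_simp
    ring
  rw [intervalIntegral.integral_eq_sub_of_hasDerivAt (fun t _ => hderiv t)
    (Continuous.intervalIntegrable (by fun_prop) _ _), psi, if_neg (mul_ne_zero hβ hs)]
  simp only [zero_mul, neg_zero, Real.exp_zero, sub_self, sub_zero]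
  field_simp
  ring

/-- For every `d ≥ 1`, every family of strictly positive reals `λ_1, …, λ_d`, and
every real `β > 0`, the `d×d` real matrix `G` with entries
`G_{ij} = ψ(β(λ_i + λ_j))/(λ_i + λ_j)` is positive semidefinite. -/
theorem psi_kernel_posSemidef (d : ℕ) (hd : 1 ≤ d) (lam : Fin d → ℝ)
    (hlam : ∀ i, 0 < lam i) (β : ℝ) (hβ : 0 < β) :
    (Matrix.of fun i j : Fin d =>
      psi (β * (lam i + lam j)) / (lam i + lam j)).PosSemidef := by
  refine Matrix.PosSemidef.of_dotProduct_mulVec_nonneg ?_ fun x => ?_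
  · ext i j
    simp [add_comm]
  have hform : star x ⬝ᵥ (Matrix.of fun i j : Fin d =>
      psi (β * (lam i + lam j)) / (lam i + lam j)).mulVec x =
      β⁻¹ * ∫ t in (0 : ℝ)..β, (β - t) * (∑ i, x i * Real.exp (-(t * lam i))) ^ 2 := by
    have hsq (t : ℝ) : (β - t) * (∑ i, x i * Real.exp (-(t * lam i))) ^ 2 =
        ∑ i, ∑ j, x i * x j * ((β - t) * Real.exp (-(t * (lam i + lam j)))) := by
      rw [sq, Finset.sum_mul_sum, Finset.mul_sum]
      refine Finset.sum_congr rfl fun i _ => ?_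
      rw [Finset.mul_sum]
      refine Finset.sum_congr rfl fun j _ => ?_
      rw [mul_add, neg_add, Real.exp_add]
      ring
    simp_rw [hsq]
    rw [intervalIntegral.integral_finsetSum fun i _ =>
      Continuous.intervalIntegrable (by fun_prop) _ _, Finset.mul_sum]
    refine Finset.sum_congr rfl fun i _ => ?_
    rw [intervalIntegral.integral_finsetSum fun j _ =>
      Continuous.intervalIntegrable (by fun_prop) _ _, Matrix.mulVec, dotProduct,
      Finset.mul_sum, Finset.mul_sum]
    refine Finset.sum_congr rfl fun j _ => ?_
    rw [intervalIntegral.integral_const_mul, Matrix.of_apply,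
      psi_mul_div_eq_integral hβ.ne' (add_pos (hlam i) (hlam j)).ne', Pi.star_apply, star_trivial]
    ring
  rw [hform]
  exact mul_nonneg (inv_nonneg.2 hβ.le) <| intervalIntegral.integral_nonneg hβ.le fun t ht =>
    mul_nonneg (sub_nonneg.2 ht.2) (sq_nonneg _)
end

section
/- Let M be a positive semidefinite real d×d matrix, let λ_1, …, λ_d be strictly positive reals, and let 0 < β₁ ≤ β₂. Then the d×d matrix with entries ((ψ(β₂(λ_i + λ_j)) − ψ(β₁(λ_i + λ_j)))/(λ_i + λ_j)) · M_{ij} is positive semidefinite; in particular, the matrix-valued function β ↦ [ψ(β(λ_i + λ_j))/(λ_i + λ_j) · M_{ij}]_{ij} is monotonically increasing in β with respect to the Loewner (positive semidefinite) order. -/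
/-- If a curve of symmetric matrices has positive semidefinite derivative on `[a, b]`, then its
increment over `[a, b]` is positive semidefinite. -/
theorem Matrix.posSemidef_sub_of_hasDerivAt {n : Type*} [Fintype n] {A A' : ℝ → Matrix n n ℝ}
    {a b : ℝ} (hab : a ≤ b) (hA : ∀ t, (A t).IsHermitian)
    (hderiv : ∀ t ∈ Set.Icc a b, ∀ i j, HasDerivAt (fun u => A u i j) (A' t i j) t)
    (hA' : ∀ t ∈ Set.Icc a b, (A' t).PosSemidef) : (A b - A a).PosSemidef := by
  refine .of_dotProduct_mulVec_nonneg ((hA b).sub (hA a)) fun x => ?_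
  have hd : ∀ t ∈ Set.Icc a b,
      HasDerivAt (fun u => star x ⬝ᵥ (A u).mulVec x) (star x ⬝ᵥ (A' t).mulVec x) t := by
    intro t ht
    simp only [dotProduct, Matrix.mulVec]
    exact HasDerivAt.fun_sum fun i _ => (HasDerivAt.fun_sum fun j _ =>
      (hderiv t ht i j).mul_const (x j)).const_mul _
  have hmono : MonotoneOn (fun u => star x ⬝ᵥ (A u).mulVec x) (Set.Icc a b) :=
    monotoneOn_of_hasDerivWithinAt_nonneg (convex_Icc a b)
      (fun t ht => (hd t ht).continuousAt.continuousWithinAt)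
      (fun t ht => (hd t (interior_subset ht)).hasDerivWithinAt)
      (fun t ht => (hA' t (interior_subset ht)).dotProduct_mulVec_nonneg x)
  rw [Matrix.sub_mulVec, dotProduct_sub, sub_nonneg]
  exact hmono (Set.left_mem_Icc.2 hab) (Set.right_mem_Icc.2 hab) hab

theorem hasDerivAt_exp_neg_mul (s t : ℝ) :
    HasDerivAt (fun u => Real.exp (-(u * s))) (-(s * Real.exp (-(t * s)))) t := by
  simpa [mul_comm] using ((hasDerivAt_id' t).mul_const s).fun_neg.exp

theorem hasDerivAt_one_sub_exp_sub_div_sq {s : ℝ} (hs : 0 < s) (t : ℝ) :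
    HasDerivAt (fun u => (1 - Real.exp (-(u * s)) - u * s * Real.exp (-(u * s))) / s ^ 2)
      (t * Real.exp (-(t * s))) t := by
  have he := hasDerivAt_exp_neg_mul s t
  refine (((he.const_sub 1).fun_sub
    (((hasDerivAt_id' t).mul_const s).fun_mul he)).div_const (s ^ 2)).congr_deriv ?_
  field_simp
  ring

theorem hasDerivAt_psi_mul_div {s t : ℝ} (hs : 0 < s) (ht : 0 < t) :
    HasDerivAt (fun u => psi (u * s) / s)
      (t⁻¹ ^ 2 * ((1 - Real.exp (-(t * s)) - t * s * Real.exp (-(t * s))) / s ^ 2)) t := by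
  have hne : t * s ≠ 0 := (mul_pos ht hs).ne'
  have hlin := (hasDerivAt_id' t).mul_const s
  have hd := ((((hasDerivAt_exp_neg_mul s t).sub_const 1).fun_add hlin).fun_div hlin hne).div_const s
  have heq : (fun u => psi (u * s) / s) =ᶠ[nhds t]
      fun u => (Real.exp (-(u * s)) - 1 + u * s) / (u * s) / s := by
    filter_upwards [lt_mem_nhds ht] with u hu
    rw [psi, if_neg (mul_pos hu hs).ne']
  refine (hd.congr_of_eventuallyEq heq).congr_deriv ?_
  field_simp
  ring

section Kernels

variable {n : Type*} [Fintype n] {lam : n → ℝ}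

theorem posSemidef_exp_neg_mul_add (lam : n → ℝ) (t : ℝ) :
    (Matrix.of fun i j => Real.exp (-(t * (lam i + lam j)))).PosSemidef := by
  convert Matrix.posSemidef_vecMulVec_self_star (fun i => Real.exp (-(t * lam i))) using 1
  ext i j
  simp only [Matrix.of_apply, Matrix.vecMulVec_apply, star_trivial,
    ← Real.exp_add]
  ring_nf

theorem posSemidef_one_sub_exp_sub_div_sq (hlam : ∀ i, 0 < lam i) {t : ℝ} (ht : 0 ≤ t) :
    (Matrix.of fun i j => (1 - Real.exp (-(t * (lam i + lam j))) -
      t * (lam i + lam j) * Real.exp (-(t * (lam i + lam j)))) / (lam i + lam j) ^ 2).PosSemidef := by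
  have h := Matrix.posSemidef_sub_of_hasDerivAt
    (A := fun u => Matrix.of fun i j => (1 - Real.exp (-(u * (lam i + lam j))) -
      u * (lam i + lam j) * Real.exp (-(u * (lam i + lam j)))) / (lam i + lam j) ^ 2)
    (A' := fun u => u • Matrix.of fun i j => Real.exp (-(u * (lam i + lam j)))) ht
    (fun u => Matrix.IsHermitian.ext fun i j => by simp [add_comm])
    (fun u _ i j => by
      simpa using hasDerivAt_one_sub_exp_sub_div_sq (add_pos (hlam i) (hlam j)) u)
    (fun u hu => (posSemidef_exp_neg_mul_add lam u).smul hu.1)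
  convert h using 1
  ext i j
  simp

theorem posSemidef_psi_sub_div (hlam : ∀ i, 0 < lam i) {β₁ β₂ : ℝ} (hβ₁ : 0 < β₁)
    (hβ : β₁ ≤ β₂) :
    (Matrix.of fun i j => (psi (β₂ * (lam i + lam j)) - psi (β₁ * (lam i + lam j))) /
      (lam i + lam j)).PosSemidef := by
  have h := Matrix.posSemidef_sub_of_hasDerivAt
    (A := fun u => Matrix.of fun i j => psi (u * (lam i + lam j)) / (lam i + lam j))
    (A' := fun u => u⁻¹ ^ 2 • Matrix.of fun i j => (1 - Real.exp (-(u * (lam i + lam j))) -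
      u * (lam i + lam j) * Real.exp (-(u * (lam i + lam j)))) / (lam i + lam j) ^ 2) hβ
    (fun u => Matrix.IsHermitian.ext fun i j => by simp [add_comm])
    (fun u hu i j => by
      simpa using hasDerivAt_psi_mul_div (add_pos (hlam i) (hlam j)) (hβ₁.trans_le hu.1))
    (fun u hu => (posSemidef_one_sub_exp_sub_div_sq hlam (hβ₁.le.trans hu.1)).smul
      (sq_nonneg _))
  convert h using 1
  ext i j
  simp [sub_div]

end Kernels

/-- Let `M` be a positive semidefinite real `d×d` matrix, let `λ_1, …, λ_d` be
strictly positive reals, and let `0 < β₁ ≤ β₂`. Then the `d×d` matrix with entries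
`((ψ(β₂(λ_i + λ_j)) − ψ(β₁(λ_i + λ_j)))/(λ_i + λ_j)) · M_{ij}` is positive
semidefinite; in particular, `β ↦ [ψ(β(λ_i + λ_j))/(λ_i + λ_j) · M_{ij}]_{ij}` is
monotonically increasing in `β` with respect to the Loewner order. -/
theorem psi_rescaled_loewner_mono (d : ℕ) (hd : 1 ≤ d) (M : Matrix (Fin d) (Fin d) ℝ)
    (hM : M.PosSemidef) (lam : Fin d → ℝ) (hlam : ∀ i, 0 < lam i)
    (β₁ β₂ : ℝ) (hβ₁ : 0 < β₁) (hβ : β₁ ≤ β₂) :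
    (Matrix.of fun i j : Fin d =>
      (psi (β₂ * (lam i + lam j)) - psi (β₁ * (lam i + lam j))) / (lam i + lam j)
        * M i j).PosSemidef ∧
    ((Matrix.of fun i j : Fin d =>
        psi (β₂ * (lam i + lam j)) / (lam i + lam j) * M i j) -
      (Matrix.of fun i j : Fin d =>
        psi (β₁ * (lam i + lam j)) / (lam i + lam j) * M i j)).PosSemidef := by
  have h := (posSemidef_psi_sub_div hlam hβ₁ hβ).hadamard hM
  refine ⟨h, ?_⟩
  have heq : ((Matrix.of fun i j : Fin d =>
        psi (β₂ * (lam i + lam j)) / (lam i + lam j) * M i j) -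
      (Matrix.of fun i j : Fin d =>
        psi (β₁ * (lam i + lam j)) / (lam i + lam j) * M i j)) =
      Matrix.hadamard (Matrix.of fun i j =>
        (psi (β₂ * (lam i + lam j)) - psi (β₁ * (lam i + lam j))) / (lam i + lam j)) M := by
    ext i j
    simp [sub_div, sub_mul]
  rw [heq]
  exact h
end
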